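/- arXiv:0909.2670 — 2 statements merged into one kernel-verified Lean document; each statement's English description precedes it below -/
import Mathlib

section
/- Suppose Φ separates V₂. Then for every n ≥ 1, the intersection of the space of G-invariant vectors of H^{⊗n} (under the diagonal action) with the subspace ⊕_{j ∈ {1,2}ⁿ} V(j) (the span of all strings containing no entry equal to 3) is exactly V₁^{⊗n} = V(1,1,…,1). (This is the abstract form of Theorem 2.5 of the paper in the case s = n, i.e. the identification BH^{n,n}(H) = EH^{n,n}(H) of top-weight Beilinson–Hodge cycles with products of weight-2 invariant classes, which underlies the proof of the Beilinson–Hodge and Beilinson–Tate conjectures for products of curves and semiabelian varieties.) -/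
/-!
Context: `K` a field, `V₁, V₂, V₃` finite-dimensional `K`-vector spaces,
`H = V₁ × V₂ × V₃`, `G_c ≤ GL(V₃)`, `Φ ≤ Hom_K(V₂,V₃)` additive and stable under
composition with `G_c`, `g_{f,S} : (v₁,v₂,v₃) ↦ (v₁, v₂, f v₂ + S v₃)`,
`G = { g_{f,S} : f ∈ Φ, S ∈ G_c }`, acting diagonally on `H^{⊗n}`.  `Φ` separates `V₂`
if every nonzero `u ∈ V₂` has `f ∈ Φ` with `f u ≠ 0`.  Strings `j ∈ {1,2,3}ⁿ` are encoded
as `j : Fin n → Fin 3` (`0` ↦ `V₁`, `1` ↦ `V₂`, `2` ↦ `V₃`).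

Statement 8: if `Φ` separates `V₂`, then for every `n ≥ 1` the intersection of the space of
`G`-invariant vectors of `H^{⊗n}` with the subspace `⊕_{j ∈ {1,2}ⁿ} V(j)` (the span of all
strings containing no entry equal to `3`, i.e. `∀ i, j i ≠ 2`) is exactly
`V₁^{⊗n} = V(1,…,1)`.
-/

open scoped TensorProduct

/-- The automorphism `g_{f,S} : (v₁,v₂,v₃) ↦ (v₁, v₂, f v₂ + S v₃)` of `H = V₁ × V₂ × V₃`. -/
def gfs {K : Type*} [Field K] {V₁ V₂ V₃ : Type*}
    [AddCommGroup V₁] [Module K V₁] [AddCommGroup V₂] [Module K V₂]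
    [AddCommGroup V₃] [Module K V₃]
    (f : V₂ →ₗ[K] V₃) (S : V₃ ≃ₗ[K] V₃) :
    (V₁ × V₂ × V₃) ≃ₗ[K] (V₁ × V₂ × V₃) where
  toFun v := (v.1, v.2.1, f v.2.1 + S v.2.2)
  invFun v := (v.1, v.2.1, S.symm (v.2.2 - f v.2.1))
  map_add' a b := by ext <;> simp <;> abel
  map_smul' c a := by ext <;> simp
  left_inv v := by simp
  right_inv v := by simp

/-- The set `G = { g_{f,S} : f ∈ Φ, S ∈ G_c } ⊆ GL(H)`. -/
def Gset {K : Type*} [Field K] {V₁ V₂ V₃ : Type*}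
    [AddCommGroup V₁] [Module K V₁] [AddCommGroup V₂] [Module K V₂]
    [AddCommGroup V₃] [Module K V₃]
    (Gc : Subgroup (V₃ ≃ₗ[K] V₃)) (Φ : AddSubgroup (V₂ →ₗ[K] V₃)) :
    Set ((V₁ × V₂ × V₃) ≃ₗ[K] (V₁ × V₂ × V₃)) :=
  {x | ∃ f ∈ Φ, ∃ S ∈ Gc, x = gfs f S}

section TensorPowerSetup

variable {K : Type*} [Field K] {V₁ V₂ V₃ : Type*}
  [AddCommGroup V₁] [Module K V₁] [AddCommGroup V₂] [Module K V₂]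
  [AddCommGroup V₃] [Module K V₃]

/-- The three summands `V₁ × 0 × 0`, `0 × V₂ × 0`, `0 × 0 × V₃` of `H = V₁ × V₂ × V₃`,
indexed by `Fin 3` (so index `0` corresponds to `V₁`, `1` to `V₂` and `2` to `V₃`). -/
def sel (K : Type*) [Field K] (V₁ V₂ V₃ : Type*)
    [AddCommGroup V₁] [Module K V₁] [AddCommGroup V₂] [Module K V₂]
    [AddCommGroup V₃] [Module K V₃] :
    Fin 3 → Submodule K (V₁ × V₂ × V₃)
  | 0 => (⊤ : Submodule K V₁).prod (((⊥ : Submodule K V₂)).prod (⊥ : Submodule K V₃))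
  | 1 => (⊥ : Submodule K V₁).prod (((⊤ : Submodule K V₂)).prod (⊥ : Submodule K V₃))
  | 2 => (⊥ : Submodule K V₁).prod (((⊥ : Submodule K V₂)).prod (⊤ : Submodule K V₃))

/-- For a string `j : Fin n → Fin 3`, the subspace `V(j) = V_{j 0} ⊗ ⋯ ⊗ V_{j (n-1)}` of
`H^{⊗n}`, realized as the span of the pure tensors whose `i`-th entry lies in the `j i`-th
summand of `H` (via the canonical inclusions `V_i ↪ H`). -/
def Vstr {n : ℕ} (j : Fin n → Fin 3) :
    Submodule K (⨂[K] (_ : Fin n), (V₁ × V₂ × V₃)) :=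
  Submodule.span K
    {x | ∃ v : Fin n → V₁ × V₂ × V₃,
      (∀ i, v i ∈ sel K V₁ V₂ V₃ (j i)) ∧ x = PiTensorProduct.tprod K v}

/-- The diagonal action of `g ∈ GL(H)` on `H^{⊗n}`, with `g` acting as `g^{⊗n}`. -/
noncomputable def actDiag (n : ℕ) (g : (V₁ × V₂ × V₃) ≃ₗ[K] (V₁ × V₂ × V₃)) :
    (⨂[K] (_ : Fin n), (V₁ × V₂ × V₃)) →ₗ[K] ⨂[K] (_ : Fin n), (V₁ × V₂ × V₃) :=
  PiTensorProduct.map fun _ => g.toLinearMap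

/-- The action of `S ∈ GL(V₃)` on `H^{⊗n}`, acting factorwise as the identity on the `V₁`-
and `V₂`-components and as `S` on the `V₃`-component; on the subspace `V(j)` this is exactly
the action of `S` on the tensor factors with `j i = 2` (i.e. the `V₃`-factors) and the
identity on all other factors. -/
noncomputable def actS (n : ℕ) (S : V₃ ≃ₗ[K] V₃) :
    (⨂[K] (_ : Fin n), (V₁ × V₂ × V₃)) →ₗ[K] ⨂[K] (_ : Fin n), (V₁ × V₂ × V₃) :=
  PiTensorProduct.map fun _ =>
    LinearMap.prodMap LinearMap.id (LinearMap.prodMap LinearMap.id S.toLinearMap)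

end TensorPowerSetup

section FixedSubmodules

variable {K : Type*} [Field K] {V₁ V₂ V₃ : Type*}
  [AddCommGroup V₁] [Module K V₁] [AddCommGroup V₂] [Module K V₂]
  [AddCommGroup V₃] [Module K V₃]

/-- The submodule of `H^{⊗n}` of vectors fixed by the diagonal action of every element
of `G`. -/
def diagFixed (Gc : Subgroup (V₃ ≃ₗ[K] V₃)) (Φ : AddSubgroup (V₂ →ₗ[K] V₃)) (n : ℕ) :
    Submodule K (⨂[K] (_ : Fin n), (V₁ × V₂ × V₃)) where
  carrier := {τ | ∀ g ∈ Gset Gc Φ, actDiag n g τ = τ}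
  add_mem' ha hb := by
    intro g hg
    rw [map_add, ha g hg, hb g hg]
  zero_mem' := by
    intro g hg
    rw [map_zero]
  smul_mem' c a ha := by
    intro g hg
    rw [map_smul, ha g hg]

/-- The submodule of `H^{⊗n}` of vectors fixed by the (factorwise) action of every element
of `G_c`. -/
def gcFixed (Gc : Subgroup (V₃ ≃ₗ[K] V₃)) (n : ℕ) :
    Submodule K (⨂[K] (_ : Fin n), (V₁ × V₂ × V₃)) where
  carrier := {τ | ∀ S ∈ Gc, actS n S τ = τ}
  add_mem' ha hb := by
    intro S hS
    rw [map_add, ha S hS, hb S hS]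
  zero_mem' := by
    intro S hS
    rw [map_zero]
  smul_mem' c a ha := by
    intro S hS
    rw [map_smul, ha S hS]

end FixedSubmodules

section Aux

variable {K : Type*} [Field K] {V₁ V₂ V₃ : Type*}
  [AddCommGroup V₁] [Module K V₁] [AddCommGroup V₂] [Module K V₂]
  [AddCommGroup V₃] [Module K V₃]

variable (K V₁ V₂ V₃) in
/-- Projection of `H` onto `V₁`. -/
def auxP1 : (V₁ × V₂ × V₃) →ₗ[K] (V₁ × V₂ × V₃) where
  toFun v := (v.1, 0, 0)
  map_add' a b := by ext <;> simp
  map_smul' c a := by ext <;> simp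

variable (K V₁ V₂ V₃) in
/-- Projection of `H` onto `V₂`. -/
def auxP2 : (V₁ × V₂ × V₃) →ₗ[K] (V₁ × V₂ × V₃) where
  toFun v := (0, v.2.1, 0)
  map_add' a b := by ext <;> simp
  map_smul' c a := by ext <;> simp

variable (K V₁ V₂ V₃) in
/-- Projection of `H` onto `V₃`. -/
def auxP3 : (V₁ × V₂ × V₃) →ₗ[K] (V₁ × V₂ × V₃) where
  toFun v := (0, 0, v.2.2)
  map_add' a b := by ext <;> simp
  map_smul' c a := by ext <;> simp

/-- The map `H → H` induced by `f : V₂ → V₃`. -/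
def auxF (f : V₂ →ₗ[K] V₃) : (V₁ × V₂ × V₃) →ₗ[K] (V₁ × V₂ × V₃) where
  toFun v := (0, 0, f v.2.1)
  map_add' a b := by ext <;> simp
  map_smul' c a := by ext <;> simp

/-- The rank one map `v ↦ φ(v₂) e`. -/
def auxR (e : V₁ × V₂ × V₃) : Module.Dual K V₂ →ₗ[K]
    ((V₁ × V₂ × V₃) →ₗ[K] (V₁ × V₂ × V₃)) where
  toFun φ := (φ ∘ₗ LinearMap.fst K V₂ V₃ ∘ₗ LinearMap.snd K V₁ (V₂ × V₃)).smulRight e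
  map_add' a b := by ext <;> simp [add_smul]
  map_smul' c a := by ext <;> simp [mul_smul]

/-- Endomorphisms `a` such that `p ⊗ ⋯ ⊗ a ⊗ ⋯ ⊗ p` kills `τ`. -/
noncomputable def auxW {n : ℕ} (p : (V₁ × V₂ × V₃) →ₗ[K] (V₁ × V₂ × V₃)) (i : Fin n)
    (τ : ⨂[K] (_ : Fin n), (V₁ × V₂ × V₃)) :
    Submodule K ((V₁ × V₂ × V₃) →ₗ[K] (V₁ × V₂ × V₃)) :=
  LinearMap.ker (((LinearMap.applyₗ τ)) ∘ₗ
    ((PiTensorProduct.mapMultilinear K (fun _ : Fin n => V₁ × V₂ × V₃)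
      (fun _ : Fin n => V₁ × V₂ × V₃)).toLinearMap (fun _ => p) i))

theorem mem_auxW {n : ℕ} (p : (V₁ × V₂ × V₃) →ₗ[K] (V₁ × V₂ × V₃)) (i : Fin n)
    (τ : ⨂[K] (_ : Fin n), (V₁ × V₂ × V₃)) (a) :
    a ∈ auxW p i τ ↔ PiTensorProduct.map (Function.update (fun _ => p) i a) τ = 0 := by
  rfl

theorem auxW_comp {n : ℕ} (p : (V₁ × V₂ × V₃) →ₗ[K] (V₁ × V₂ × V₃)) (i : Fin n)
    (τ : ⨂[K] (_ : Fin n), (V₁ × V₂ × V₃)) (a b) (h : a ∈ auxW p i τ) :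
    b ∘ₗ a ∈ auxW p i τ := by
  rw [mem_auxW] at h ⊢
  have : (Function.update (fun _ => p) i (b ∘ₗ a) : Fin n → _) =
      fun k => (Function.update (fun _ => LinearMap.id) i b : Fin n → _) k ∘ₗ
        (Function.update (fun _ => p) i a : Fin n → _) k := by
    funext k
    by_cases hk : k = i
    · subst hk; simp
    · simp [hk]
  rw [this, PiTensorProduct.map_comp, LinearMap.comp_apply, h, map_zero]

theorem span_top_of_sep [FiniteDimensional K V₂] (Φ : AddSubgroup (V₂ →ₗ[K] V₃))
    (hsep : ∀ u : V₂, u ≠ 0 → ∃ f ∈ Φ, f u ≠ 0) (W : Submodule K (Module.Dual K V₂))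
    (hW : ∀ f ∈ Φ, ∀ ψ : Module.Dual K V₃, ψ ∘ₗ f ∈ W) : W = ⊤ := by
  have h : W.dualCoannihilator = ⊥ := by
    rw [eq_bot_iff]
    intro u hu
    rw [Submodule.mem_bot]
    by_contra hne
    obtain ⟨f, hf, hfu⟩ := hsep u hne
    apply hfu
    rw [← Module.forall_dual_apply_eq_zero_iff K]
    intro ψ
    exact (Submodule.mem_dualCoannihilator _).1 hu _ (hW f hf ψ)
  rw [← Subspace.dualCoannihilator_dualAnnihilator_eq (W := W), h]
  simp

theorem auxP2_mem [FiniteDimensional K V₂] (Φ : AddSubgroup (V₂ →ₗ[K] V₃))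
    (hsep : ∀ u : V₂, u ≠ 0 → ∃ f ∈ Φ, f u ≠ 0)
    {n : ℕ} (p : (V₁ × V₂ × V₃) →ₗ[K] (V₁ × V₂ × V₃)) (i : Fin n)
    (τ : ⨂[K] (_ : Fin n), (V₁ × V₂ × V₃)) (h : ∀ f ∈ Φ, auxF f ∈ auxW p i τ) :
    auxP2 K V₁ V₂ V₃ ∈ auxW p i τ := by
  have key : ∀ e φ, auxR e φ ∈ auxW p i τ := by
    intro e φ
    have ht := span_top_of_sep Φ hsep ((auxW p i τ).comap (auxR e)) (by
      intro f hf ψ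
      have := auxW_comp p i τ (auxF f)
        ((ψ ∘ₗ LinearMap.snd K V₂ V₃ ∘ₗ LinearMap.snd K V₁ (V₂ × V₃)).smulRight e) (h f hf)
      exact this)
    have : φ ∈ (auxW p i τ).comap (auxR e) := by rw [ht]; trivial
    exact this
  let B := Module.finBasis K V₂
  have hB : auxP2 K V₁ V₂ V₃ = ∑ k, auxR (0, B k, 0) (B.coord k) := by
    apply LinearMap.ext
    intro v
    rw [LinearMap.sum_apply]
    have : ∀ k, (auxR (0, B k, 0) (B.coord k) : (V₁ × V₂ × V₃) →ₗ[K] (V₁ × V₂ × V₃)) v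
        = (LinearMap.inr K V₁ (V₂ × V₃) ∘ₗ LinearMap.inl K V₂ V₃) (B.repr v.2.1 k • B k) := by
      intro k
      simp [auxR]
    rw [Finset.sum_congr rfl (fun k _ => this k), ← map_sum, B.sum_repr]
    rfl
  rw [hB]
  exact Submodule.sum_mem _ fun k _ => key _ _

theorem aux_hybrid {n : ℕ} (τ : ⨂[K] (_ : Fin n), (V₁ × V₂ × V₃))
    (h12 : PiTensorProduct.map (fun _ => auxP1 K V₁ V₂ V₃ + auxP2 K V₁ V₂ V₃) τ = τ)
    (h : ∀ i, auxP2 K V₁ V₂ V₃ ∈ auxW (auxP1 K V₁ V₂ V₃ + auxP2 K V₁ V₂ V₃) i τ)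
    (s : Finset (Fin n)) :
    PiTensorProduct.map (fun k => if k ∈ s then auxP1 K V₁ V₂ V₃
      else auxP1 K V₁ V₂ V₃ + auxP2 K V₁ V₂ V₃) τ = τ := by
  induction s using Finset.induction_on with
  | empty => simpa using h12
  | insert i s hi ih =>
    set p := auxP1 K V₁ V₂ V₃ + auxP2 K V₁ V₂ V₃ with hp
    set F : Fin n → ((V₁ × V₂ × V₃) →ₗ[K] (V₁ × V₂ × V₃)) :=
      fun k => if k ∈ s then auxP1 K V₁ V₂ V₃ else p with hF
    have e1 : (fun k => if k ∈ insert i s then auxP1 K V₁ V₂ V₃ else p)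
        = Function.update F i (auxP1 K V₁ V₂ V₃) := by
      funext k
      by_cases hk : k = i
      · subst hk; simp
      · simp [hk, hF]
    have e2 : F = Function.update F i (auxP1 K V₁ V₂ V₃ + auxP2 K V₁ V₂ V₃) := by
      funext k
      by_cases hk : k = i
      · subst hk; simp [hF, hi, hp]
      · simp [hk]
    have e3 : Function.update F i (auxP2 K V₁ V₂ V₃) = fun k =>
        (if k ∈ s then auxP1 K V₁ V₂ V₃ else LinearMap.id) ∘ₗ
          (Function.update (fun _ => p) i (auxP2 K V₁ V₂ V₃) : Fin n → _) k := by
      funext k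
      by_cases hk : k = i
      · subst hk; simp [hi]
      · by_cases hks : k ∈ s
        · simp only [Function.update_of_ne hk, hF, hks, if_true]
          ext v <;> simp [hp, auxP1, auxP2]
        · simp [hk, hF, hks]
    have e4 : PiTensorProduct.map (Function.update F i (auxP2 K V₁ V₂ V₃)) τ = 0 := by
      rw [e3, PiTensorProduct.map_comp, LinearMap.comp_apply, (mem_auxW _ _ _ _).1 (h i), map_zero]
    rw [e2, PiTensorProduct.map_update_add, LinearMap.add_apply, e4, add_zero] at ih
    rw [e1, ih]

theorem sel_ne_two {c : Fin 3} (hc : c ≠ 2) {v : V₁ × V₂ × V₃}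
    (hv : v ∈ sel K V₁ V₂ V₃ c) : v.2.2 = 0 := by
  fin_cases c
  · simp [sel, Submodule.mem_prod] at hv; simp [hv]
  · simp [sel, Submodule.mem_prod] at hv; exact hv.2
  · exact absurd rfl hc

theorem aux_agree {n : ℕ} (τ : ⨂[K] (_ : Fin n), (V₁ × V₂ × V₃))
    (hτ : τ ∈ ⨆ j ∈ {j : Fin n → Fin 3 | ∀ i, j i ≠ 2},
            Vstr (K := K) (V₁ := V₁) (V₂ := V₂) (V₃ := V₃) j)
    (A B : (⨂[K] (_ : Fin n), (V₁ × V₂ × V₃)) →ₗ[K] ⨂[K] (_ : Fin n), (V₁ × V₂ × V₃))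
    (hAB : ∀ v : Fin n → V₁ × V₂ × V₃, (∀ i, (v i).2.2 = 0) →
      A (PiTensorProduct.tprod K v) = B (PiTensorProduct.tprod K v)) : A τ = B τ := by
  have : (⨆ j ∈ {j : Fin n → Fin 3 | ∀ i, j i ≠ 2},
            Vstr (K := K) (V₁ := V₁) (V₂ := V₂) (V₃ := V₃) j) ≤ LinearMap.eqLocus A B := by
    refine iSup₂_le fun j hj => Submodule.span_le.2 ?_
    rintro x ⟨v, hv, rfl⟩
    exact hAB v fun i => sel_ne_two (hj i) (hv i)
  exact this hτ

theorem auxF_mem {n : ℕ} (f : V₂ →ₗ[K] V₃) (τ : ⨂[K] (_ : Fin n), (V₁ × V₂ × V₃))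
    (hτ : τ ∈ ⨆ j ∈ {j : Fin n → Fin 3 | ∀ i, j i ≠ 2},
            Vstr (K := K) (V₁ := V₁) (V₂ := V₂) (V₃ := V₃) j)
    (hf : actDiag n (gfs f 1) τ = τ) (i : Fin n) :
    auxF f ∈ auxW (auxP1 K V₁ V₂ V₃ + auxP2 K V₁ V₂ V₃) i τ := by
  set p := auxP1 K V₁ V₂ V₃ + auxP2 K V₁ V₂ V₃ with hp
  have h3 : auxP3 K V₁ V₂ V₃ ∈ auxW p i τ := by
    rw [mem_auxW]
    refine aux_agree τ hτ _ 0 fun v hv => ?_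
    rw [PiTensorProduct.map_tprod, LinearMap.zero_apply]
    apply MultilinearMap.map_coord_zero _ i
    simp [auxP3, hv i]
  have h4 : auxP3 K V₁ V₂ V₃ ∘ₗ (gfs f 1).toLinearMap ∈ auxW p i τ := by
    rw [mem_auxW] at h3 ⊢
    have : (Function.update (fun _ => p) i (auxP3 K V₁ V₂ V₃ ∘ₗ (gfs f 1).toLinearMap) :
        Fin n → _) = fun k => (Function.update (fun _ => p) i (auxP3 K V₁ V₂ V₃) : Fin n → _) k ∘ₗ
          (gfs f 1).toLinearMap := by
      funext k
      by_cases hk : k = i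
      · subst hk; simp
      · simp only [Function.update_of_ne hk]
        ext v <;> simp [hp, auxP1, auxP2, gfs]
    rw [this, PiTensorProduct.map_comp, LinearMap.comp_apply]
    unfold actDiag at hf
    rw [hf, h3]
  have : auxF f = auxP3 K V₁ V₂ V₃ ∘ₗ (gfs f 1).toLinearMap - auxP3 K V₁ V₂ V₃ := by
    apply LinearMap.ext
    intro v
    simp [auxF, auxP3, gfs]
  rw [this]
  exact Submodule.sub_mem _ h4 h3

end Aux

theorem top_weight_invariants_eq_tensor_power_of_V1
    {K : Type*} [Field K] {V₁ V₂ V₃ : Type*}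
    [AddCommGroup V₁] [Module K V₁] [FiniteDimensional K V₁]
    [AddCommGroup V₂] [Module K V₂] [FiniteDimensional K V₂]
    [AddCommGroup V₃] [Module K V₃] [FiniteDimensional K V₃]
    (Gc : Subgroup (V₃ ≃ₗ[K] V₃)) (Φ : AddSubgroup (V₂ →ₗ[K] V₃))
    (hΦ : ∀ S ∈ Gc, ∀ f ∈ Φ, S.toLinearMap ∘ₗ f ∈ Φ)
    (hsep : ∀ u : V₂, u ≠ 0 → ∃ f ∈ Φ, f u ≠ 0)
    {n : ℕ} (hn : 1 ≤ n) :
    diagFixed (V₁ := V₁) Gc Φ n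
        ⊓ (⨆ j ∈ {j : Fin n → Fin 3 | ∀ i, j i ≠ 2},
            Vstr (K := K) (V₁ := V₁) (V₂ := V₂) (V₃ := V₃) j)
      = Vstr (fun _ => (0 : Fin 3)) := by
  apply le_antisymm
  · rintro τ ⟨hfix, hτ⟩
    have h12 : PiTensorProduct.map (fun _ => auxP1 K V₁ V₂ V₃ + auxP2 K V₁ V₂ V₃) τ = τ := by
      refine aux_agree τ hτ _ LinearMap.id fun v hv => ?_
      rw [PiTensorProduct.map_tprod, LinearMap.id_apply]
      congr 1
      funext i
      ext <;> simp [auxP1, auxP2, hv i]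
    have h := aux_hybrid τ h12 (fun i => auxP2_mem Φ hsep _ i τ fun f hf =>
      auxF_mem f τ hτ (hfix _ ⟨f, hf, 1, Gc.one_mem, rfl⟩) i) Finset.univ
    simp only [Finset.mem_univ, if_true] at h
    rw [← h]
    have hall : ∀ x : ⨂[K] (_ : Fin n), (V₁ × V₂ × V₃),
        PiTensorProduct.map (fun _ => auxP1 K V₁ V₂ V₃) x ∈
          Vstr (K := K) (V₁ := V₁) (V₂ := V₂) (V₃ := V₃) (fun _ : Fin n => (0 : Fin 3)) := by
      intro x
      induction x using PiTensorProduct.induction_on with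
      | smul_tprod r v =>
        rw [map_smul, PiTensorProduct.map_tprod]
        refine Submodule.smul_mem _ _ (Submodule.subset_span ⟨_, fun i => ?_, rfl⟩)
        simp [sel, auxP1, Submodule.mem_prod]
      | add x y hx hy => rw [map_add]; exact Submodule.add_mem _ hx hy
    exact hall τ
  · refine le_inf ?_ ?_
    · refine Submodule.span_le.2 ?_
      rintro x ⟨v, hv, rfl⟩
      rintro g ⟨f, hf, S, hS, rfl⟩
      unfold actDiag
      rw [PiTensorProduct.map_tprod]
      congr 1
      funext i
      have := hv i
      simp [sel, Submodule.mem_prod] at this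
      ext <;> simp [gfs, this]
    · exact le_iSup₂_of_le (fun _ => (0 : Fin 3)) (by simp) le_rfl
end

section
/- Suppose K has characteristic zero and Φ separates V₂. Consider the induced action of G on the n-th exterior power ΛⁿH. Then the intersection of the space of G-invariant vectors of ΛⁿH with the subspace Λⁿ(V₁ × V₂ × 0) is exactly ΛⁿV₁ (the image of Λⁿ of the inclusion V₁ ↪ H). (This is the exterior-algebra form of the top-weight case of Theorem 2.5 of the paper, which applies to semiabelian varieties, where Hⁿ(U) = ΛⁿH¹(U) is a direct summand of the n-fold tensor power of H¹(U), as used in Corollary 3.4 and Proposition 3.7.) -/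
section ExteriorSetup

variable {K : Type*} [Field K] {V₁ V₂ V₃ : Type*}
  [AddCommGroup V₁] [Module K V₁] [AddCommGroup V₂] [Module K V₂]
  [AddCommGroup V₃] [Module K V₃]

/-- The submodule of the exterior algebra of `H` consisting of the vectors fixed by `Λg`
for every `g ∈ G`; its intersection with `⋀[K]^n H` is the space of `G`-invariant vectors
of `ΛⁿH` under the action `g ↦ Λⁿg`. -/
def extFixed (Gc : Subgroup (V₃ ≃ₗ[K] V₃)) (Φ : AddSubgroup (V₂ →ₗ[K] V₃)) :
    Submodule K (ExteriorAlgebra K (V₁ × V₂ × V₃)) where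
  carrier := {x | ∀ g ∈ Gset Gc Φ, (ExteriorAlgebra.map g.toLinearMap).toLinearMap x = x}
  add_mem' ha hb := by
    intro g hg
    rw [map_add, ha g hg, hb g hg]
  zero_mem' := by
    intro g hg
    rw [map_zero]
  smul_mem' c a ha := by
    intro g hg
    rw [map_smul, ha g hg]

/-- `Λⁿ(V₁ × V₂ × 0) ⊆ ΛⁿH`: the image of `⋀[K]^n (V₁ × V₂)` under `Λ` of the inclusion
`(v₁, v₂) ↦ (v₁, v₂, 0)`. -/
def extPowerV12 (n : ℕ) : Submodule K (ExteriorAlgebra K (V₁ × V₂ × V₃)) :=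
  Submodule.map
    (ExteriorAlgebra.map
      (LinearMap.prodMap (LinearMap.id : V₁ →ₗ[K] V₁)
        (LinearMap.inl K V₂ V₃))).toLinearMap
    (⋀[K]^n (V₁ × V₂))

/-- `ΛⁿV₁ ⊆ ΛⁿH`: the image of `⋀[K]^n V₁` under `Λ` of the inclusion `v₁ ↦ (v₁, 0, 0)`. -/
def extPowerV1 (n : ℕ) : Submodule K (ExteriorAlgebra K (V₁ × V₂ × V₃)) :=
  Submodule.map
    (ExteriorAlgebra.map (LinearMap.inl K V₁ (V₂ × V₃))).toLinearMap
    (⋀[K]^n V₁)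

end ExteriorSetup

section ExtHelpers

variable {K : Type*} [Field K] {M N : Type*} [AddCommGroup M] [Module K M]
  [AddCommGroup N] [Module K N]

/-- Left contraction on the exterior algebra. -/
noncomputable def extContr (d : Module.Dual K M) : ExteriorAlgebra K M →ₗ[K] ExteriorAlgebra K M :=
  CliffordAlgebra.contractLeft (Q := (0 : QuadraticForm K M)) d

theorem extContr_algebraMap (d : Module.Dual K M) (r : K) :
    extContr d (algebraMap K (ExteriorAlgebra K M) r) = 0 :=
  CliffordAlgebra.contractLeft_algebraMap (Q := (0 : QuadraticForm K M)) d r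

theorem extContr_ι_mul (d : Module.Dual K M) (m : M) (x : ExteriorAlgebra K M) :
    extContr d (ExteriorAlgebra.ι K m * x)
      = d m • x - ExteriorAlgebra.ι K m * extContr d x :=
  CliffordAlgebra.contractLeft_ι_mul (Q := (0 : QuadraticForm K M)) d m x

theorem extContr_add (d e : Module.Dual K M) (x : ExteriorAlgebra K M) :
    extContr (d + e) x = extContr d x + extContr e x := by
  simp only [extContr, map_add, LinearMap.add_apply]

theorem extContr_smul (c : K) (d : Module.Dual K M) (x : ExteriorAlgebra K M) :
    extContr (c • d) x = c • extContr d x := by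
  simp only [extContr, map_smul, LinearMap.smul_apply]

theorem extContr_zero (x : ExteriorAlgebra K M) :
    extContr (0 : Module.Dual K M) x = 0 := by
  simp only [extContr, map_zero, LinearMap.zero_apply]

theorem ext_left_induction {P : ExteriorAlgebra K M → Prop}
    (h1 : ∀ r : K, P (algebraMap K _ r))
    (h2 : ∀ x y, P x → P y → P (x + y))
    (h3 : ∀ x m, P x → P (ExteriorAlgebra.ι K m * x)) (x : ExteriorAlgebra K M) : P x :=
  CliffordAlgebra.left_induction (Q := (0 : QuadraticForm K M)) h1 h2 h3 x

/-- Naturality of contraction. -/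
theorem extContr_map (g : M →ₗ[K] N) (d : Module.Dual K N) (x : ExteriorAlgebra K M) :
    extContr d (ExteriorAlgebra.map g x) = ExteriorAlgebra.map g (extContr (d ∘ₗ g) x) := by
  induction x using ext_left_induction with
  | h1 r => rw [AlgHom.commutes, extContr_algebraMap, extContr_algebraMap, map_zero]
  | h2 x y hx hy => rw [map_add, map_add, map_add, map_add, hx, hy]
  | h3 x m hx =>
    rw [map_mul, ExteriorAlgebra.map_apply_ι, extContr_ι_mul, hx, extContr_ι_mul, map_sub,
      map_smul, map_mul, ExteriorAlgebra.map_apply_ι, LinearMap.comp_apply]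

/-- `Λ(id - w ⊗ d) x = x - w ∧ (d ⌋ x)`. -/
theorem ext_map_transvection (d : Module.Dual K M) (w : M) (x : ExteriorAlgebra K M) :
    ExteriorAlgebra.map (LinearMap.id - d.smulRight w) x
      = x - ExteriorAlgebra.ι K w * extContr d x := by
  induction x using ext_left_induction with
  | h1 r => rw [AlgHom.commutes, extContr_algebraMap, mul_zero, sub_zero]
  | h2 x y hx hy => rw [map_add, map_add, hx, hy, mul_add]; abel
  | h3 x m hx =>
    have e1 : ExteriorAlgebra.ι K w * ExteriorAlgebra.ι K w = 0 := ExteriorAlgebra.ι_sq_zero w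
    have e2 : ExteriorAlgebra.ι K m * ExteriorAlgebra.ι K w
        = - (ExteriorAlgebra.ι K w * ExteriorAlgebra.ι K m) :=
      eq_neg_of_add_eq_zero_left (ExteriorAlgebra.ι_add_mul_swap m w)
    have e3 : ExteriorAlgebra.ι K w * (ExteriorAlgebra.ι K w * extContr d x) = 0 := by
      rw [← mul_assoc, e1, zero_mul]
    have e4 : ExteriorAlgebra.ι K m * (ExteriorAlgebra.ι K w * extContr d x)
        = - (ExteriorAlgebra.ι K w * (ExteriorAlgebra.ι K m * extContr d x)) := by
      rw [← mul_assoc, e2, neg_mul, mul_assoc]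
    rw [map_mul, ExteriorAlgebra.map_apply_ι, extContr_ι_mul, hx]
    simp only [LinearMap.sub_apply, LinearMap.id_apply, LinearMap.smulRight_apply, map_sub,
      map_smul, sub_mul, mul_sub, smul_mul_assoc, mul_smul_comm, e3, e4, smul_zero]
    abel

theorem ext_map_mem (g : M →ₗ[K] N) (n : ℕ) {x : ExteriorAlgebra K M} (hx : x ∈ ⋀[K]^n M) :
    ExteriorAlgebra.map g x ∈ ⋀[K]^n N := by
  have h : Submodule.map (ExteriorAlgebra.map g).toLinearMap (⋀[K]^n M) ≤ ⋀[K]^n N := by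
    rw [ExteriorAlgebra.exteriorPower, ExteriorAlgebra.exteriorPower, Submodule.map_pow, ExteriorAlgebra.ι_range_map_map]
    exact pow_le_pow_left' LinearMap.map_le_range n
  exact h ⟨x, hx, rfl⟩

theorem ext_map_map {L : Type*} [AddCommGroup L] [Module K L] (g : M →ₗ[K] N) (h : N →ₗ[K] L)
    (x : ExteriorAlgebra K M) :
    ExteriorAlgebra.map h (ExteriorAlgebra.map g x) = ExteriorAlgebra.map (h ∘ₗ g) x := by
  rw [← ExteriorAlgebra.map_comp_map]; rfl

/-- An element killed by contraction with all functionals on the second factor comes from the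
first factor. -/
theorem ext_map_fst_of_contr [FiniteDimensional K N] (x : ExteriorAlgebra K (M × N))
    (hx : ∀ d : Module.Dual K N, extContr (d ∘ₗ LinearMap.snd K M N) x = 0) :
    ExteriorAlgebra.map (LinearMap.inl K M N) (ExteriorAlgebra.map (LinearMap.fst K M N) x)
      = x := by
  classical
  let b := Module.finBasis K N
  have key : ∀ s : Finset (Fin (Module.finrank K N)),
      ExteriorAlgebra.map (LinearMap.id - ∑ i ∈ s,
        (b.coord i ∘ₗ LinearMap.snd K M N).smulRight ((0, b i) : M × N)) x = x := by
    intro s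
    induction s using Finset.induction_on with
    | empty => simp
    | insert a s ha ih =>
      have e : (LinearMap.id - ∑ i ∈ insert a s,
          (b.coord i ∘ₗ LinearMap.snd K M N).smulRight ((0, b i) : M × N))
          = (LinearMap.id - ∑ i ∈ s,
          (b.coord i ∘ₗ LinearMap.snd K M N).smulRight ((0, b i) : M × N)) ∘ₗ
          (LinearMap.id - (b.coord a ∘ₗ LinearMap.snd K M N).smulRight ((0, b a) : M × N)) := by
        have z : (∑ i ∈ s, (b.coord i ∘ₗ LinearMap.snd K M N).smulRight ((0, b i) : M × N))
            ((0, b a) : M × N) = 0 := by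
          rw [LinearMap.sum_apply]
          refine Finset.sum_eq_zero fun i hi => ?_
          have : a ≠ i := fun h => ha (h ▸ hi)
          simp [Finsupp.single_eq_of_ne this.symm]
        refine LinearMap.ext fun v => ?_
        rw [Finset.sum_insert ha]
        simp only [LinearMap.sub_apply, LinearMap.comp_apply, LinearMap.id_apply,
          LinearMap.add_apply, map_sub]
        rw [LinearMap.smulRight_apply, map_smul, z]
        simp only [smul_zero]
        abel
      rw [e, ← ext_map_map, ext_map_transvection, hx, mul_zero, sub_zero, ih]
  have h := key Finset.univ
  rw [ext_map_map]
  convert h using 2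
  congr 1
  refine LinearMap.ext fun v => ?_
  have hs : ∑ i, b.repr v.2 i • ((0, b i) : M × N) = (0, v.2) := by
    conv_rhs => rw [← b.sum_repr v.2]
    ext <;> simp [Prod.fst_sum, Prod.snd_sum]
  simp only [LinearMap.sub_apply, LinearMap.id_apply, LinearMap.sum_apply,
    LinearMap.smulRight_apply, LinearMap.comp_apply, LinearMap.snd_apply,
    Module.Basis.coord_apply, hs]
  ext <;> simp

end ExtHelpers

theorem exterior_power_invariants_eq_exterior_power_of_V1
    {K : Type*} [Field K] [CharZero K] {V₁ V₂ V₃ : Type*}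
    [AddCommGroup V₁] [Module K V₁] [FiniteDimensional K V₁]
    [AddCommGroup V₂] [Module K V₂] [FiniteDimensional K V₂]
    [AddCommGroup V₃] [Module K V₃] [FiniteDimensional K V₃]
    (Gc : Subgroup (V₃ ≃ₗ[K] V₃)) (Φ : AddSubgroup (V₂ →ₗ[K] V₃))
    (hΦ : ∀ S ∈ Gc, ∀ f ∈ Φ, S.toLinearMap ∘ₗ f ∈ Φ)
    (hsep : ∀ u : V₂, u ≠ 0 → ∃ f ∈ Φ, f u ≠ 0)
    (n : ℕ) :
    ((⋀[K]^n (V₁ × V₂ × V₃)) ⊓ extFixed Gc Φ) ⊓ extPowerV12 n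
      = extPowerV1 (V₂ := V₂) (V₃ := V₃) n := by
  apply le_antisymm
  · rintro x ⟨⟨hn, hfix⟩, ⟨y, -, rfl⟩⟩
    set j : V₁ × V₂ →ₗ[K] V₁ × V₂ × V₃ :=
      LinearMap.prodMap (LinearMap.id : V₁ →ₗ[K] V₁) (LinearMap.inl K V₂ V₃) with hj
    set x := (ExteriorAlgebra.map j).toLinearMap y with hxdef
    let p2 : V₁ × V₂ × V₃ →ₗ[K] V₂ := LinearMap.fst K V₂ V₃ ∘ₗ LinearMap.snd K V₁ (V₂ × V₃)
    let p3 : V₁ × V₂ × V₃ →ₗ[K] V₃ := LinearMap.snd K V₂ V₃ ∘ₗ LinearMap.snd K V₁ (V₂ × V₃)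
    have h3 : ∀ l : Module.Dual K V₃, extContr (l ∘ₗ p3) x = 0 := by
      intro l
      have e : (l ∘ₗ p3) ∘ₗ j = 0 := by
        refine LinearMap.ext fun v => ?_
        simp [p3, hj]
      have := extContr_map j (l ∘ₗ p3) y
      rw [e, extContr_zero, map_zero] at this
      exact this
    have h2 : ∀ l : Module.Dual K V₃, ∀ f ∈ Φ, extContr ((l ∘ₗ f) ∘ₗ p2) x = 0 := by
      intro l f hf
      have hg := hfix (gfs f 1) ⟨f, hf, 1, Gc.one_mem, rfl⟩
      have e : (l ∘ₗ p3) ∘ₗ (gfs f 1 : (V₁ × V₂ × V₃) ≃ₗ[K] _).toLinearMap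
          = (l ∘ₗ f) ∘ₗ p2 + l ∘ₗ p3 := by
        refine LinearMap.ext fun v => ?_
        simp [p2, p3, gfs]
      have h := extContr_map (gfs f 1 : (V₁ × V₂ × V₃) ≃ₗ[K] _).toLinearMap (l ∘ₗ p3) x
      rw [AlgHom.toLinearMap_apply] at hg
      rw [hg, h3, e, extContr_add, h3, add_zero] at h
      have h' := congrArg (ExteriorAlgebra.map
        (gfs f 1 : (V₁ × V₂ × V₃) ≃ₗ[K] _).symm.toLinearMap) h.symm
      rw [ext_map_map, LinearEquiv.comp_coe, LinearEquiv.self_trans_symm,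
        LinearEquiv.refl_toLinearMap, ExteriorAlgebra.map_id, map_zero] at h'
      exact h'
    let W : Submodule K (Module.Dual K V₂) :=
      { carrier := {d | extContr (d ∘ₗ p2) x = 0}
        add_mem' := by
          intro a b ha hb
          simp only [Set.mem_ofPred_eq] at ha hb ⊢
          rw [LinearMap.add_comp, extContr_add, ha, hb, add_zero]
        zero_mem' := by
          simp only [Set.mem_ofPred_eq]
          rw [LinearMap.zero_comp, extContr_zero]
        smul_mem' := by
          intro c a ha
          simp only [Set.mem_ofPred_eq] at ha ⊢
          rw [LinearMap.smul_comp, extContr_smul, ha, smul_zero] }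
    have hW : W = ⊤ := by
      have hbot : W.dualCoannihilator = ⊥ := by
        rw [eq_bot_iff]
        intro u hu
        rw [Submodule.mem_dualCoannihilator] at hu
        by_contra hne
        obtain ⟨f, hf, hfu⟩ := hsep u hne
        apply hfu
        rw [← Module.forall_dual_apply_eq_zero_iff K]
        intro l
        exact hu (l ∘ₗ f) (h2 l f hf)
      rw [← Subspace.dualCoannihilator_dualAnnihilator_eq (W := W), hbot,
        Submodule.dualAnnihilator_bot]
    refine ⟨ExteriorAlgebra.map (LinearMap.fst K V₁ (V₂ × V₃)) x, ext_map_mem _ n hn, ?_⟩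
    refine ext_map_fst_of_contr x fun d => ?_
    have e : d ∘ₗ LinearMap.snd K V₁ (V₂ × V₃)
        = (d ∘ₗ LinearMap.inl K V₂ V₃) ∘ₗ p2 + (d ∘ₗ LinearMap.inr K V₂ V₃) ∘ₗ p3 := by
      refine LinearMap.ext fun v => ?_
      simp [p2, p3, ← map_add]
    have hm : d ∘ₗ LinearMap.inl K V₂ V₃ ∈ W := hW ▸ Submodule.mem_top
    have hm' : extContr ((d ∘ₗ LinearMap.inl K V₂ V₃) ∘ₗ p2) x = 0 := hm
    rw [e, extContr_add, h3, hm', add_zero]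
  · rintro _ ⟨y, hy, rfl⟩
    refine ⟨⟨ext_map_mem _ n hy, ?_⟩, ?_⟩
    · rintro _ ⟨f, -, S, -, rfl⟩
      simp only [AlgHom.toLinearMap_apply]
      rw [ext_map_map]
      congr 2
      refine LinearMap.ext fun v => ?_
      simp [gfs]
    · refine ⟨ExteriorAlgebra.map (LinearMap.inl K V₁ V₂) y, ext_map_mem _ n hy, ?_⟩
      simp only [AlgHom.toLinearMap_apply]
      rw [ext_map_map]
      congr 2
end
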